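/- Let 0 ≤ r and let e ∈ H^{(r+2)}(m), f ∈ H^{(r+1)}(m) be Boolean functions in m variables, and let p be the Boolean function in m+1 variables defined by p(x₁,…,x_m,x_{m+1}) = e(x₁,…,x_m) + f(x₁,…,x_m)·x_{m+1}. Then the weight enumerator of the coset p + R(r+1, m+1) equals ∑_{g ∈ H^{(r+1)}(m)} W[z; e+g+R(r,m)] · W[z; e+g+f+R(r,m)]. -/

import Mathlib

open Finset Polynomial

/-- A Boolean function in `m` variables. -/
abbrev BF (m : ℕ) := (Fin m → ZMod 2) → ZMod 2

/-- The coefficient of the monomial `∏_{i ∈ S} x i` in the algebraic normal form of `f`: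
by Möbius inversion over `𝔽₂`, it equals the sum of `f x` over all inputs `x`
whose support is contained in `S`. -/
def anf {m : ℕ} (f : BF m) (S : Finset (Fin m)) : ZMod 2 :=
  ∑ x ∈ Finset.univ.filter (fun x : Fin m → ZMod 2 => ∀ i, x i = 1 → i ∈ S), f x

/-- The Reed–Muller code `R(r,m)`: Boolean functions in `m` variables of
algebraic degree at most `r`. -/
def RM (r m : ℕ) : Finset (BF m) :=
  Finset.univ.filter (fun f => ∀ S : Finset (Fin m), r < S.card → anf f S = 0)

/-- `H^{(r)}(m)`: Boolean functions in `m` variables whose algebraic normal form is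
homogeneous of degree `r`, together with the zero function. -/
def Hom (r m : ℕ) : Finset (BF m) :=
  Finset.univ.filter (fun f => ∀ S : Finset (Fin m), anf f S ≠ 0 → S.card = r)

/-- The Hamming weight of a Boolean function. -/
def wt {m : ℕ} (f : BF m) : ℕ := (Finset.univ.filter (fun x => f x = 1)).card

/-- The coset `p + C`. -/
def coset {m : ℕ} (p : BF m) (C : Finset (BF m)) : Finset (BF m) :=
  C.image (fun g => p + g)

/-- The weight enumerator `W[z; C] = ∑_{f ∈ C} z^{wt f}` of a finite set `C` of
Boolean functions. -/
noncomputable def WE {m : ℕ} (C : Finset (BF m)) : Polynomial ℕ :=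
  ∑ f ∈ C, X ^ wt f

/-- Restriction of a function in `m + 1` variables to the hyperplane where the last
variable equals `c`. -/
def restrictLast {m : ℕ} (q : BF (m + 1)) (c : ZMod 2) : BF m :=
  fun y => q (Fin.snoc y c)

/-- The function in `m + 1` variables whose restrictions to the hyperplanes `0` and `1` of the
last variable are `u` and `v`. -/
def joinLast {m : ℕ} (u v : BF m) : BF (m + 1) :=
  fun x => if x (Fin.last m) = 0 then u (x ∘ Fin.castSucc) else v (x ∘ Fin.castSucc)

lemma restrictLast_joinLast_zero {m : ℕ} (u v : BF m) : restrictLast (joinLast u v) 0 = u := by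
  ext y; simp [restrictLast, joinLast]

lemma restrictLast_joinLast_one {m : ℕ} (u v : BF m) : restrictLast (joinLast u v) 1 = v := by
  ext y; simp [restrictLast, joinLast]

lemma joinLast_restrictLast {m : ℕ} (q : BF (m + 1)) :
    joinLast (restrictLast q 0) (restrictLast q 1) = q := by
  ext x
  have hx : (Fin.snoc (x ∘ Fin.castSucc) (x (Fin.last m)) : Fin (m + 1) → ZMod 2) = x :=
    Fin.snoc_init_self x
  have h2 : ∀ c : ZMod 2, c = 0 ∨ c = 1 := by decide
  rcases h2 (x (Fin.last m)) with h | h <;> rw [h] at hx <;> simp [restrictLast, joinLast, h, hx]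

lemma sum_cube_succ {m : ℕ} {M : Type*} [AddCommMonoid M] (F : (Fin (m + 1) → ZMod 2) → M) :
    ∑ x, F x = ∑ y : Fin m → ZMod 2, F (Fin.snoc y 0) + ∑ y : Fin m → ZMod 2, F (Fin.snoc y 1) := by
  rw [← (Fin.snocEquiv (fun _ : Fin (m + 1) => ZMod 2)).sum_comp, Fintype.sum_prod_type]
  exact Fin.sum_univ_two fun c : Fin 2 =>
    ∑ y : Fin m → ZMod 2, F ((Fin.snoc y (c : ZMod 2) : Fin (m + 1) → ZMod 2))

lemma wt_eq_add {m : ℕ} (q : BF (m + 1)) :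
    wt q = wt (restrictLast q 0) + wt (restrictLast q 1) := by
  simp only [wt, Finset.card_filter]
  exact sum_cube_succ fun x => if q x = 1 then 1 else 0

lemma anf_add {m : ℕ} (f g : BF m) (S : Finset (Fin m)) :
    anf (f + g) S = anf f S + anf g S := by
  simp [anf, Finset.sum_add_distrib]

/-- The algebraic normal form of `q` in terms of its two restrictions. -/
lemma anf_eq_add {m : ℕ} (q : BF (m + 1)) (T : Finset (Fin (m + 1))) (S : Finset (Fin m))
    (hS : ∀ i, Fin.castSucc i ∈ T ↔ i ∈ S) :
    anf q T = anf (restrictLast q 0) S +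
      if Fin.last m ∈ T then anf (restrictLast q 1) S else 0 := by
  simp only [anf, Finset.sum_filter]
  rw [sum_cube_succ]
  split_ifs with h <;> simp [Fin.forall_fin_succ', hS, h, restrictLast]

lemma eq_zero_of_anf_eq_zero {m : ℕ} (f : BF m) (h : ∀ S, anf f S = 0) : f = 0 := by
  suffices H : ∀ (S : Finset (Fin m)) (x : Fin m → ZMod 2), (∀ i, x i = 1 ↔ i ∈ S) → f x = 0 by
    ext x
    exact H (Finset.univ.filter fun i => x i = 1) x (by simp)
  intro S
  induction S using Finset.strongInduction with
  | H S ih =>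
    intro x hx
    rw [← h S, anf, Finset.sum_eq_single x]
    · intro y hy hyx
      have hy' : ∀ i, y i = 1 → i ∈ S := by simpa using hy
      refine ih (Finset.univ.filter fun i => y i = 1) ?_ y (by simp)
      refine Finset.ssubset_iff_subset_ne.2 ⟨fun i hi => hy' i (by simpa using hi), fun hE => hyx ?_⟩
      have h2 : ∀ a b : ZMod 2, (a = 1 ↔ b = 1) → a = b := by decide
      ext1 i
      apply h2
      rw [hx, ← hE]
      simp
    · intro hn
      exact absurd (by simpa using fun i => (hx i).1) hn

lemma add_self_bf {m : ℕ} (f : BF m) : f + f = 0 := by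
  ext x; exact CharTwo.add_self_eq_zero _

lemma eq_of_add_eq_zero_bf {m : ℕ} {f g : BF m} (h : f + g = 0) : f = g := by
  ext x; exact CharTwo.add_eq_zero.1 (congrFun h x)

lemma anf_injective (m : ℕ) : Function.Injective (anf : BF m → Finset (Fin m) → ZMod 2) := by
  intro f g hfg
  apply eq_of_add_eq_zero_bf
  apply eq_zero_of_anf_eq_zero
  intro S
  rw [anf_add, hfg]
  exact CharTwo.add_self_eq_zero _

/-- Every family of coefficients is the algebraic normal form of a Boolean function. -/
lemma anf_surjective (m : ℕ) : Function.Surjective (anf : BF m → Finset (Fin m) → ZMod 2) :=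
  ((Fintype.bijective_iff_injective_and_card _).2 ⟨anf_injective m, by simp⟩).2

lemma mem_RM {r m : ℕ} {f : BF m} :
    f ∈ RM r m ↔ ∀ S : Finset (Fin m), r < S.card → anf f S = 0 := by
  simp [RM]

lemma mem_Hom {r m : ℕ} {f : BF m} :
    f ∈ Hom r m ↔ ∀ S : Finset (Fin m), anf f S ≠ 0 → S.card = r := by
  simp [Hom]

lemma add_mem_RM {r m : ℕ} {f g : BF m} (hf : f ∈ RM r m) (hg : g ∈ RM r m) : f + g ∈ RM r m := by
  rw [mem_RM] at *
  intro S hS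
  rw [anf_add, hf S hS, hg S hS, add_zero]

lemma RM_mono {r s m : ℕ} (hrs : r ≤ s) {f : BF m} (hf : f ∈ RM r m) : f ∈ RM s m :=
  mem_RM.2 fun S hS => mem_RM.1 hf S (hrs.trans_lt hS)

lemma Hom_subset_RM {r m : ℕ} {f : BF m} (hf : f ∈ Hom r m) : f ∈ RM r m :=
  mem_RM.2 fun S hS => by_contra fun h => hS.ne' (mem_Hom.1 hf S h)

lemma exists_Hom_add_RM {r m : ℕ} {u : BF m} (hu : u ∈ RM (r + 1) m) :
    ∃ g ∈ Hom (r + 1) m, g + u ∈ RM r m := by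
  obtain ⟨g, hg⟩ := anf_surjective m fun S => if S.card = r + 1 then anf u S else 0
  refine ⟨g, mem_Hom.2 fun S hS => ?_, mem_RM.2 fun S hS => ?_⟩
  · by_contra h
    simp [hg, h] at hS
  · rw [anf_add, hg]
    dsimp only
    split_ifs with h
    · exact CharTwo.add_self_eq_zero _
    · rw [zero_add]
      exact mem_RM.1 hu S (by omega)

lemma Hom_eq_of_add_mem_RM {r m : ℕ} {g h : BF m} (hg : g ∈ Hom (r + 1) m)
    (hh : h ∈ Hom (r + 1) m) (H : g + h ∈ RM r m) : g = h := by
  apply anf_injective m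
  ext1 S
  by_cases hS : S.card = r + 1
  · have := mem_RM.1 H S (by omega)
    rw [anf_add] at this
    exact CharTwo.add_eq_zero.1 this
  · rw [not_not.1 (mt (mem_Hom.1 hg S) hS), not_not.1 (mt (mem_Hom.1 hh S) hS)]

/-- The `(u | u + v)` construction of the Reed–Muller codes. -/
lemma mem_RM_succ {r m : ℕ} {q : BF (m + 1)} :
    q ∈ RM (r + 1) (m + 1) ↔
      restrictLast q 0 ∈ RM (r + 1) m ∧ restrictLast q 0 + restrictLast q 1 ∈ RM r m := by
  constructor
  · intro hq
    rw [mem_RM] at hq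
    refine ⟨mem_RM.2 fun S hS => ?_, mem_RM.2 fun S hS => ?_⟩
    · have := hq (S.map Fin.castSuccEmb) (by simpa using hS)
      rw [anf_eq_add q _ S (by simp)] at this
      simpa using this
    · have := hq (insert (Fin.last m) (S.map Fin.castSuccEmb))
        (by rw [Finset.card_insert_of_notMem (by simp)]; simpa using hS)
      rw [anf_eq_add q _ S (by simp [(Fin.castSucc_lt_last _).ne])] at this
      simpa [anf_add] using this
  · rintro ⟨h0, h1⟩
    refine mem_RM.2 fun T hT => ?_
    have hT' : T.card = (Finset.univ.filter fun i : Fin m => Fin.castSucc i ∈ T).card +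
        if Fin.last m ∈ T then 1 else 0 := by
      rw [← Finset.filter_univ_mem T, Finset.card_filter, Fin.sum_univ_castSucc, Finset.card_filter]
      simp
    rw [anf_eq_add q T (Finset.univ.filter fun i => Fin.castSucc i ∈ T) (by simp)]
    split_ifs at hT' ⊢ with h
    · rw [← anf_add]
      exact mem_RM.1 h1 _ (by omega)
    · rw [mem_RM.1 h0 _ (by omega), add_zero]

lemma WE_coset {m : ℕ} (p : BF m) (C : Finset (BF m)) :
    WE (coset p C) = ∑ g ∈ C, X ^ wt (p + g) := by
  rw [WE, coset, Finset.sum_image fun _ _ _ _ h => add_left_cancel h]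


/-- Theorem 2 (Sarwate): for `p = e + f·x_{m+1}` with `e ∈ H^{(r+2)}(m)` and
`f ∈ H^{(r+1)}(m)`, the weight enumerator of `p + R(r+1, m+1)` equals
`∑_{g ∈ H^{(r+1)}(m)} W[z; e+g+R(r,m)] · W[z; e+g+f+R(r,m)]`. -/
theorem statement1 (r m : ℕ) (e f : BF m)
    (he : e ∈ Hom (r + 2) m) (hf : f ∈ Hom (r + 1) m)
    (p : BF (m + 1))
    (hp : ∀ x : Fin (m + 1) → ZMod 2,
      p x = e (x ∘ Fin.castSucc) + f (x ∘ Fin.castSucc) * x (Fin.last m)) :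
    WE (coset p (RM (r + 1) (m + 1))) =
      ∑ g ∈ Hom (r + 1) m,
        WE (coset (e + g) (RM r m)) * WE (coset (e + g + f) (RM r m)) := by
  have hp0 : restrictLast p 0 = e := by
    ext y; simp [restrictLast, hp]
  have hp1 : restrictLast p 1 = e + f := by
    ext y; simp [restrictLast, hp]
  have hadd : ∀ (q : BF (m + 1)) (c : ZMod 2),
      restrictLast (p + q) c = restrictLast p c + restrictLast q c := fun _ _ => rfl
  have cancel : ∀ g a b : BF m, (g + a) + (g + b) = a + b := fun g a b => by
    rw [add_add_add_comm, add_self_bf, zero_add]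
  simp only [WE_coset, Finset.sum_mul_sum, ← pow_add, ← Finset.sum_product']
  symm
  refine Finset.sum_bij (fun t _ => joinLast (t.1 + t.2.1) (t.1 + t.2.2)) ?_ ?_ ?_ ?_
  · rintro ⟨g, a, b⟩ h
    simp only [Finset.mem_product] at h
    obtain ⟨hg, ha, hb⟩ := h
    rw [mem_RM_succ, restrictLast_joinLast_zero, restrictLast_joinLast_one, cancel]
    exact ⟨add_mem_RM (Hom_subset_RM hg) (RM_mono (Nat.le_succ r) ha), add_mem_RM ha hb⟩
  · rintro ⟨g, a, b⟩ h ⟨g', a', b'⟩ h' H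
    simp only [Finset.mem_product] at h h'
    have H0 := congrArg (restrictLast · 0) H
    have H1 := congrArg (restrictLast · 1) H
    simp only [restrictLast_joinLast_zero, restrictLast_joinLast_one] at H0 H1
    have hgg : g = g' := by
      refine Hom_eq_of_add_mem_RM h.1 h'.1 ?_
      have : g + g' = a + a' := by
        apply eq_of_add_eq_zero_bf
        rw [add_add_add_comm, H0, add_self_bf]
      rw [this]
      exact add_mem_RM h.2.1 h'.2.1
    subst hgg
    rw [add_left_cancel H0, add_left_cancel H1]
  · intro q hq
    obtain ⟨h0, h1⟩ := mem_RM_succ.1 hq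
    obtain ⟨g, hg, ha⟩ := exists_Hom_add_RM h0
    have hb : g + restrictLast q 1 ∈ RM r m := by
      have := add_mem_RM ha h1
      rwa [add_comm g, cancel] at this
    refine ⟨(g, g + restrictLast q 0, g + restrictLast q 1), by simp [hg, ha, hb], ?_⟩
    simp only [← add_assoc, add_self_bf, zero_add, joinLast_restrictLast]
  · rintro ⟨g, a, b⟩ -
    rw [wt_eq_add, hadd, hadd, hp0, hp1, restrictLast_joinLast_zero, restrictLast_joinLast_one]
    congr 3 <;> abel
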